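/- There is no binary form f ∈ V_10 such that simultaneously: (f,f)_10 = 0, the covariant k = (f,f)_8 is a nonzero scalar multiple of x^3 y, and the invariants j_9 = ((m,k)_1,k^2)_8, A_14 = (((k,k)_2)^2,(m,m)_2)_8, j_10 = ((m,m)_2,k^2)_8 and A_6 = (m,m)_6 all vanish at f, where m = (f,k)_4. -/

import Mathlib

open MvPolynomial

/-- The `k`-th transvectant of two binary forms `f` of degree `n` and `g` of degree `m`. -/
noncomputable def transv (n m k : ℕ)
    (f g : MvPolynomial (Fin 2) ℂ) : MvPolynomial (Fin 2) ℂ :=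
  ((((n - k).factorial * (m - k).factorial : ℕ) : ℂ) / ((n.factorial * m.factorial : ℕ) : ℂ)) •
    ∑ i ∈ Finset.range (k + 1),
      ((-1 : ℂ) ^ i * (k.choose i : ℂ)) •
        ((fun p => pderiv (0 : Fin 2) p)^[k - i] ((fun p => pderiv (1 : Fin 2) p)^[i] f) *
         (fun p => pderiv (0 : Fin 2) p)^[i] ((fun p => pderiv (1 : Fin 2) p)^[k - i] g))

/-- A binary form `f` has a root of multiplicity (at least) `r` if some nonzero linear
form `ℓ = αx + βy` satisfies `ℓ^r ∣ f`. -/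
def HasRootOfMult (r : ℕ) (f : MvPolynomial (Fin 2) ℂ) : Prop :=
  ∃ a b : ℂ, (a ≠ 0 ∨ b ≠ 0) ∧ (C a * X 0 + C b * X 1) ^ r ∣ f

/-- The covariant `k = (f,f)₈ ∈ V₄` of a binary decimic `f`. -/
noncomputable def covK (f : MvPolynomial (Fin 2) ℂ) : MvPolynomial (Fin 2) ℂ :=
  transv 10 10 8 f f

/-- The covariant `m = (f,k)₄ ∈ V₆` of a binary decimic `f`. -/
noncomputable def covM (f : MvPolynomial (Fin 2) ℂ) : MvPolynomial (Fin 2) ℂ :=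
  transv 10 4 4 f (covK f)

/-- The covariant `q = (f,f)₆ ∈ V₈` of a binary decimic `f`. -/
noncomputable def covQ (f : MvPolynomial (Fin 2) ℂ) : MvPolynomial (Fin 2) ℂ :=
  transv 10 10 6 f f

/-- The covariant `r = (f,q)₈ ∈ V₂` of a binary decimic `f`. -/
noncomputable def covR (f : MvPolynomial (Fin 2) ℂ) : MvPolynomial (Fin 2) ℂ :=
  transv 10 8 8 f (covQ f)

/-- The covariant `k_q = (q,q)₆ ∈ V₄` of a binary decimic `f`. -/
noncomputable def covKq (f : MvPolynomial (Fin 2) ℂ) : MvPolynomial (Fin 2) ℂ :=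
  transv 8 8 6 (covQ f) (covQ f)

/-- The covariant `k_m = (m,m)₄ ∈ V₄` of a binary decimic `f`. -/
noncomputable def covKm (f : MvPolynomial (Fin 2) ℂ) : MvPolynomial (Fin 2) ℂ :=
  transv 6 6 4 (covM f) (covM f)

/-- The covariant `m_q = (q,k_q)₄ ∈ V₄` of a binary decimic `f`. -/
noncomputable def covMq (f : MvPolynomial (Fin 2) ℂ) : MvPolynomial (Fin 2) ℂ :=
  transv 8 4 4 (covQ f) (covKq f)

/-- The invariant `j₂ = (f,f)₁₀` of a binary decimic `f` (a form of order 0, i.e. a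
constant polynomial). -/
noncomputable def j2 (f : MvPolynomial (Fin 2) ℂ) : MvPolynomial (Fin 2) ℂ :=
  transv 10 10 10 f f

/-- The invariant `j₄ = (k,k)₄` of a binary decimic `f`. -/
noncomputable def j4 (f : MvPolynomial (Fin 2) ℂ) : MvPolynomial (Fin 2) ℂ :=
  transv 4 4 4 (covK f) (covK f)

/-- The invariant `j₆ = ((k,k)₂,k)₄` of a binary decimic `f`. -/
noncomputable def j6 (f : MvPolynomial (Fin 2) ℂ) : MvPolynomial (Fin 2) ℂ :=
  transv 4 4 4 (transv 4 4 2 (covK f) (covK f)) (covK f)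

/-- The invariant `A₆ = (m,m)₆` of a binary decimic `f`. -/
noncomputable def A6 (f : MvPolynomial (Fin 2) ℂ) : MvPolynomial (Fin 2) ℂ :=
  transv 6 6 6 (covM f) (covM f)

/-- The invariant `B₆ = ((q,q)₄,q)₈` of a binary decimic `f`. -/
noncomputable def B6 (f : MvPolynomial (Fin 2) ℂ) : MvPolynomial (Fin 2) ℂ :=
  transv 8 8 8 (transv 8 8 4 (covQ f) (covQ f)) (covQ f)

/-- The invariant `C₆ = (r,r)₂` of a binary decimic `f`. -/
noncomputable def C6 (f : MvPolynomial (Fin 2) ℂ) : MvPolynomial (Fin 2) ℂ :=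
  transv 2 2 2 (covR f) (covR f)

/-- The invariant `j₈ = (k,k_m)₄` of a binary decimic `f`. -/
noncomputable def j8 (f : MvPolynomial (Fin 2) ℂ) : MvPolynomial (Fin 2) ℂ :=
  transv 4 4 4 (covK f) (covKm f)

/-- The invariant `j₉ = ((m,k)₁,k²)₈` of a binary decimic `f`. -/
noncomputable def j9 (f : MvPolynomial (Fin 2) ℂ) : MvPolynomial (Fin 2) ℂ :=
  transv 8 8 8 (transv 6 4 1 (covM f) (covK f)) (covK f ^ 2)

/-- The invariant `j₁₀ = ((m,m)₂,k²)₈` of a binary decimic `f`. -/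
noncomputable def j10 (f : MvPolynomial (Fin 2) ℂ) : MvPolynomial (Fin 2) ℂ :=
  transv 8 8 8 (transv 6 6 2 (covM f) (covM f)) (covK f ^ 2)

/-- The invariant `A₁₂ = (m²,k³)₁₂` of a binary decimic `f`. -/
noncomputable def A12 (f : MvPolynomial (Fin 2) ℂ) : MvPolynomial (Fin 2) ℂ :=
  transv 12 12 12 (covM f ^ 2) (covK f ^ 3)

/-- The invariant `j₁₄ = ((k_q,k_q)₂,m_q)₄` of a binary decimic `f`. -/
noncomputable def j14 (f : MvPolynomial (Fin 2) ℂ) : MvPolynomial (Fin 2) ℂ :=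
  transv 4 4 4 (transv 4 4 2 (covKq f) (covKq f)) (covMq f)

/-- The invariant `A₁₄ = (((k,k)₂)²,(m,m)₂)₈` of a binary decimic `f`. -/
noncomputable def A14 (f : MvPolynomial (Fin 2) ℂ) : MvPolynomial (Fin 2) ℂ :=
  transv 8 8 8 (transv 4 4 2 (covK f) (covK f) ^ 2) (transv 6 6 2 (covM f) (covM f))

/-- The binary form `∑ binom(n,i) aᵢ x^(n-i) y^i` with normalized coefficients `a`. -/
noncomputable def binaryForm (n : ℕ) (a : ℕ → ℂ) : MvPolynomial (Fin 2) ℂ :=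
  ∑ i ∈ Finset.range (n + 1), C ((n.choose i : ℂ) * a i) * (X 0 ^ (n - i) * X 1 ^ i)

theorem X_pow_mul_X_pow_eq_monomial (i j : ℕ) :
    (X 0 ^ i * X 1 ^ j : MvPolynomial (Fin 2) ℂ) =
      monomial (Finsupp.single 0 i + Finsupp.single 1 j) 1 := by
  simp [X_pow_eq_monomial, monomial_mul]

theorem coeff_binaryForm (n : ℕ) (a : ℕ → ℂ) (d : Fin 2 →₀ ℕ) :
    coeff d (binaryForm n a) = if d 0 + d 1 = n then (n.choose (d 1) : ℂ) * a (d 1) else 0 := by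
  have key : ∀ i j : ℕ, (Finsupp.single 0 i + Finsupp.single 1 j = d) ↔ (i = d 0 ∧ j = d 1) := by
    intro i j
    constructor
    · rintro rfl
      simp
    · rintro ⟨rfl, rfl⟩
      ext t
      fin_cases t <;> simp
  simp only [binaryForm, coeff_sum, X_pow_mul_X_pow_eq_monomial, coeff_C_mul, coeff_monomial, key]
  split_ifs with h
  · rw [Finset.sum_eq_single (d 1)]
    · rw [if_pos ⟨by omega, rfl⟩, mul_one]
    · intro i _ hi
      simp [hi]
    · intro hi
      simp only [Finset.mem_range] at hi
      omega
  · refine Finset.sum_eq_zero fun i hi => ?_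
    simp only [Finset.mem_range] at hi
    rw [if_neg (by omega), mul_zero]

theorem binaryForm_injective {n : ℕ} {a b : ℕ → ℂ} (h : binaryForm n a = binaryForm n b)
    {i : ℕ} (hi : i ≤ n) : a i = b i := by
  have hc := congrArg (coeff (Finsupp.single 0 (n - i) + Finsupp.single 1 i)) h
  have hn : n - i + i = n := by omega
  have h0 : (n.choose i : ℂ) ≠ 0 := by exact_mod_cast (Nat.choose_pos hi).ne'
  simpa [coeff_binaryForm, hn, h0] using hc

theorem binaryForm_eq_zero {n : ℕ} {a : ℕ → ℂ} (h : binaryForm n a = 0)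
    {i : ℕ} (hi : i ≤ n) : a i = 0 := by
  refine binaryForm_injective (b := fun _ => 0) (h.trans ?_) hi
  simp [binaryForm]

theorem MvPolynomial.IsHomogeneous.exists_eq_binaryForm {n : ℕ} {f : MvPolynomial (Fin 2) ℂ}
    (hf : f.IsHomogeneous n) : ∃ a, f = binaryForm n a := by
  refine ⟨fun i => coeff (Finsupp.single 0 (n - i) + Finsupp.single 1 i) f / (n.choose i : ℂ), ?_⟩
  ext d
  rw [coeff_binaryForm]
  split_ifs with h
  · have h0 : (n.choose (d 1) : ℂ) ≠ 0 := by
      exact_mod_cast (Nat.choose_pos (show d 1 ≤ n by omega)).ne'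
    rw [mul_div_cancel₀ _ h0]
    congr 1
    ext t
    fin_cases t
    · simp
      omega
    · simp
  · refine hf.coeff_eq_zero fun hd => h ?_
    rw [← hd, Finsupp.degree_eq_sum, Fin.sum_univ_two]

theorem pderiv_zero_binaryForm (n : ℕ) (a : ℕ → ℂ) :
    pderiv 0 (binaryForm (n + 1) a) = C ((n : ℂ) + 1) * binaryForm n a := by
  rw [binaryForm, Finset.sum_range_succ, binaryForm, map_add, map_sum, Finset.mul_sum]
  have hlast : pderiv (0 : Fin 2) (C (((n + 1).choose (n + 1) : ℂ) * a (n + 1)) *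
      (X 0 ^ (n + 1 - (n + 1)) * X 1 ^ (n + 1)) : MvPolynomial (Fin 2) ℂ) = 0 := by
    simp [pderiv_X]
  rw [hlast, add_zero]
  refine Finset.sum_congr rfl fun i hi => ?_
  obtain ⟨k, rfl⟩ : ∃ k, n = i + k := ⟨n - i, by simp at hi; omega⟩
  have hc := Nat.choose_mul_succ_eq (i + k) i
  have e : i + k + 1 - i = k + 1 := by omega
  rw [e] at hc ⊢
  have hc' := congrArg (fun t : ℕ => (C (t : ℂ) : MvPolynomial (Fin 2) ℂ)) hc
  simp [pderiv_X] at hc' ⊢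
  linear_combination (-C (a i) * X 0 ^ k * X 1 ^ i) * hc'

theorem pderiv_one_binaryForm (n : ℕ) (a : ℕ → ℂ) :
    pderiv 1 (binaryForm (n + 1) a) = C ((n : ℂ) + 1) * binaryForm n (fun i => a (i + 1)) := by
  rw [binaryForm, Finset.sum_range_succ', binaryForm, map_add, map_sum, Finset.mul_sum]
  have hfirst : pderiv (1 : Fin 2) (C (((n + 1).choose 0 : ℂ) * a 0) *
      (X 0 ^ (n + 1 - 0) * X 1 ^ 0) : MvPolynomial (Fin 2) ℂ) = 0 := by
    simp [pderiv_X]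
  rw [hfirst, add_zero]
  refine Finset.sum_congr rfl fun i hi => ?_
  have hc := Nat.add_one_mul_choose_eq n i
  have hc' := congrArg (fun t : ℕ => (C (t : ℂ) : MvPolynomial (Fin 2) ℂ)) hc
  simp [pderiv_X] at hc' ⊢
  linear_combination (-C (a (i + 1)) * X 0 ^ (n - i) * X 1 ^ i) * hc'

theorem iterate_pderiv_zero_binaryForm (i n : ℕ) (a : ℕ → ℂ) :
    (fun p => pderiv (0 : Fin 2) p)^[i] (binaryForm (n + i) a) =
      C (((n + i).factorial : ℂ) / (n.factorial : ℂ)) * binaryForm n a := by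
  induction i generalizing n with
  | zero => simp [Nat.factorial_ne_zero]
  | succ i ih =>
    have h := ih (n + 1)
    rw [show n + 1 + i = n + (i + 1) by ring] at h
    rw [Function.iterate_succ_apply', h]
    simp only [pderiv_C_mul, pderiv_zero_binaryForm]
    rw [← mul_assoc, ← C_mul]
    congr 2
    rw [Nat.factorial_succ n]
    have : (n.factorial : ℂ) ≠ 0 := by exact_mod_cast Nat.factorial_ne_zero n
    have : (n : ℂ) + 1 ≠ 0 := by exact_mod_cast Nat.succ_ne_zero n
    push_cast
    field_simp

theorem iterate_pderiv_one_binaryForm (i n : ℕ) (a : ℕ → ℂ) :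
    (fun p => pderiv (1 : Fin 2) p)^[i] (binaryForm (n + i) a) =
      C (((n + i).factorial : ℂ) / (n.factorial : ℂ)) * binaryForm n (fun l => a (l + i)) := by
  induction i generalizing n with
  | zero => simp [Nat.factorial_ne_zero]
  | succ i ih =>
    have h := ih (n + 1)
    rw [show n + 1 + i = n + (i + 1) by ring] at h
    rw [Function.iterate_succ_apply', h]
    simp only [pderiv_C_mul, pderiv_one_binaryForm]
    rw [← mul_assoc, ← C_mul]
    have e : (fun l => a (l + 1 + i)) = fun l => a (l + (i + 1)) := by
      funext l
      rw [add_right_comm, add_assoc]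
    rw [e]
    congr 2
    rw [Nat.factorial_succ n]
    have : (n.factorial : ℂ) ≠ 0 := by exact_mod_cast Nat.factorial_ne_zero n
    have : (n : ℂ) + 1 ≠ 0 := by exact_mod_cast Nat.succ_ne_zero n
    push_cast
    field_simp

theorem iterate_pderiv_zero_C_mul (i : ℕ) (c : ℂ) (p : MvPolynomial (Fin 2) ℂ) :
    (fun p => pderiv (0 : Fin 2) p)^[i] (C c * p) =
      C c * (fun p => pderiv (0 : Fin 2) p)^[i] p := by
  induction i with
  | zero => rfl
  | succ i ih => rw [Function.iterate_succ_apply', ih, Function.iterate_succ_apply',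
      pderiv_C_mul]

theorem iterate_pderiv_binaryForm {n k : ℕ} (hk : k ≤ n) {i j : ℕ} (hij : i + j = k) (a : ℕ → ℂ) :
    (fun p => pderiv (0 : Fin 2) p)^[i] ((fun p => pderiv (1 : Fin 2) p)^[j] (binaryForm n a)) =
      C ((n.factorial : ℂ) / ((n - k).factorial : ℂ)) *
        binaryForm (n - k) (fun l => a (l + j)) := by
  obtain ⟨m, rfl⟩ : ∃ m, n = m + i + j := ⟨n - k, by omega⟩
  have e : m + i + j - k = m := by omega
  rw [iterate_pderiv_one_binaryForm, iterate_pderiv_zero_C_mul, iterate_pderiv_zero_binaryForm, e,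
    ← mul_assoc, ← C_mul]
  congr 2
  have : (m.factorial : ℂ) ≠ 0 := by exact_mod_cast Nat.factorial_ne_zero m
  have : ((m + i).factorial : ℂ) ≠ 0 := by exact_mod_cast Nat.factorial_ne_zero _
  field_simp

theorem binaryForm_mul (p q : ℕ) (a b : ℕ → ℂ) :
    binaryForm p a * binaryForm q b = binaryForm (p + q) (fun l =>
      (∑ u ∈ Finset.HasAntidiagonal.antidiagonal l, (p.choose u.1 : ℂ) * (q.choose u.2 : ℂ) * (a u.1 * b u.2)) /
        ((p + q).choose l : ℂ)) := by
  rw [binaryForm, binaryForm, binaryForm, Finset.sum_mul_sum, ← Finset.sum_product']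
  rw [← Finset.sum_fiberwise_of_maps_to (g := fun u : ℕ × ℕ => u.1 + u.2)
    (t := Finset.range (p + q + 1)) (by
      intro u hu
      simp only [Finset.mem_product, Finset.mem_range] at hu ⊢
      omega)]
  refine Finset.sum_congr rfl fun l hl => ?_
  have hl' : l ≤ p + q := by simp at hl; omega
  have h0 : ((p + q).choose l : ℂ) ≠ 0 := by exact_mod_cast (Nat.choose_pos hl').ne'
  rw [mul_div_cancel₀ _ h0, map_sum, Finset.sum_mul]
  refine Finset.sum_subset_zero_on_sdiff (fun u hu => ?_) (fun u hu => ?_) (fun u hu => ?_)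
  · simp only [Finset.mem_filter] at hu
    simpa using hu.2
  · simp only [Finset.mem_sdiff, Finset.mem_filter, Finset.mem_product, Finset.mem_range,
      Finset.HasAntidiagonal.mem_antidiagonal] at hu
    obtain h | h : p < u.1 ∨ q < u.2 := by omega
    · simp [Nat.choose_eq_zero_of_lt h]
    · simp [Nat.choose_eq_zero_of_lt h]
  · simp only [Finset.mem_filter, Finset.mem_product, Finset.mem_range] at hu
    obtain ⟨⟨h1, h2⟩, rfl⟩ := hu
    rw [show p + q - (u.1 + u.2) = (p - u.1) + (q - u.2) by omega]
    simp only [C_mul, pow_add]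
    ring

theorem C_mul_binaryForm (n : ℕ) (c : ℂ) (a : ℕ → ℂ) :
    C c * binaryForm n a = binaryForm n (fun l => c * a l) := by
  rw [binaryForm, binaryForm, Finset.mul_sum]
  refine Finset.sum_congr rfl fun i _ => ?_
  simp only [C_mul]
  ring

theorem sum_binaryForm {ι : Type*} (s : Finset ι) (n : ℕ) (a : ι → ℕ → ℂ) :
    ∑ i ∈ s, binaryForm n (a i) = binaryForm n (fun l => ∑ i ∈ s, a i l) := by
  simp only [binaryForm]
  rw [Finset.sum_comm]
  refine Finset.sum_congr rfl fun i _ => ?_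
  rw [← Finset.sum_mul, Finset.mul_sum, map_sum]

/-- The normalized coefficients of the `k`-th transvectant of two binary forms of degrees `n`, `m`
with normalized coefficients `a`, `b`. -/
noncomputable def transvCoeff (n m k : ℕ) (a b : ℕ → ℂ) (l : ℕ) : ℂ :=
  ∑ i ∈ Finset.range (k + 1), (-1) ^ i * (k.choose i : ℂ) *
    ((∑ u ∈ Finset.HasAntidiagonal.antidiagonal l, ((n - k).choose u.1 : ℂ) * ((m - k).choose u.2 : ℂ) *
      (a (u.1 + i) * b (u.2 + (k - i)))) / ((n - k + (m - k)).choose l : ℂ))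

theorem transv_binaryForm {n m k : ℕ} (hn : k ≤ n) (hm : k ≤ m) (a b : ℕ → ℂ) :
    transv n m k (binaryForm n a) (binaryForm m b) =
      binaryForm (n - k + (m - k)) (transvCoeff n m k a b) := by
  have hterm : ∀ i ∈ Finset.range (k + 1), ((-1 : ℂ) ^ i * (k.choose i : ℂ)) •
      ((fun p => pderiv (0 : Fin 2) p)^[k - i]
          ((fun p => pderiv (1 : Fin 2) p)^[i] (binaryForm n a)) *
        (fun p => pderiv (0 : Fin 2) p)^[i]
          ((fun p => pderiv (1 : Fin 2) p)^[k - i] (binaryForm m b))) =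
      C ((n.factorial : ℂ) / ((n - k).factorial : ℂ) *
        ((m.factorial : ℂ) / ((m - k).factorial : ℂ))) *
      binaryForm (n - k + (m - k)) (fun l => (-1) ^ i * (k.choose i : ℂ) *
        ((∑ u ∈ Finset.HasAntidiagonal.antidiagonal l, ((n - k).choose u.1 : ℂ) * ((m - k).choose u.2 : ℂ) *
          (a (u.1 + i) * b (u.2 + (k - i)))) / ((n - k + (m - k)).choose l : ℂ))) := by
    intro i hi
    have hi' : i ≤ k := by simp at hi; omega
    rw [iterate_pderiv_binaryForm hn (show k - i + i = k by omega),
      iterate_pderiv_binaryForm hm (show i + (k - i) = k by omega), ← C_mul_binaryForm,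
      ← binaryForm_mul (n - k) (m - k) (fun l => a (l + i)) (fun l => b (l + (k - i))),
      smul_eq_C_mul]
    simp only [C_mul]
    ring
  rw [transv, Finset.sum_congr rfl hterm, ← Finset.mul_sum, sum_binaryForm, smul_eq_C_mul,
    ← mul_assoc, ← C_mul]
  have h1 : (n.factorial : ℂ) ≠ 0 := by exact_mod_cast Nat.factorial_ne_zero _
  have h2 : (m.factorial : ℂ) ≠ 0 := by exact_mod_cast Nat.factorial_ne_zero _
  have h3 : ((n - k).factorial : ℂ) ≠ 0 := by exact_mod_cast Nat.factorial_ne_zero _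
  have h4 : ((m - k).factorial : ℂ) ≠ 0 := by exact_mod_cast Nat.factorial_ne_zero _
  have hs : (((n - k).factorial * (m - k).factorial : ℕ) : ℂ) /
      ((n.factorial * m.factorial : ℕ) : ℂ) * ((n.factorial : ℂ) / ((n - k).factorial : ℂ) *
        ((m.factorial : ℂ) / ((m - k).factorial : ℂ))) = 1 := by
    push_cast
    field_simp
  rw [hs, C_1, one_mul]
  rfl

theorem C_mul_monomial_eq_binaryForm {n i : ℕ} (hi : i ≤ n) (c : ℂ) :
    C c * (X 0 ^ (n - i) * X 1 ^ i) =
      binaryForm n (fun l => if l = i then c / (n.choose i : ℂ) else 0) := by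
  have h0 : (n.choose i : ℂ) ≠ 0 := by exact_mod_cast (Nat.choose_pos hi).ne'
  rw [binaryForm, Finset.sum_eq_single i]
  · rw [if_pos rfl, mul_div_cancel₀ _ h0]
  · intro j _ hj
    simp [hj]
  · intro h
    simp only [Finset.mem_range] at h
    omega

/-- There is no binary decimic `f ∈ V₁₀` with `(f,f)₁₀ = 0`, whose covariant
`k = (f,f)₈` is a nonzero scalar multiple of `x³y`, and at which the invariants
`j₉, A₁₄, j₁₀, A₆` all vanish. -/
theorem case_k_x3y_impossible :
    ¬ ∃ f : MvPolynomial (Fin 2) ℂ, f.IsHomogeneous 10 ∧ j2 f = 0 ∧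
      (∃ c : ℂ, c ≠ 0 ∧ covK f = C c * (X 0 ^ 3 * X 1)) ∧
      j9 f = 0 ∧ A14 f = 0 ∧ j10 f = 0 ∧ A6 f = 0 := by
  rintro ⟨f, hf, h2, ⟨c, hc, hK⟩, h9, h14, h10, h6⟩
  obtain ⟨a, rfl⟩ := hf.exists_eq_binaryForm
  have hK1 : covK (binaryForm 10 a) = binaryForm 4 (fun l => if l = 1 then c / 4 else 0) := by
    rw [hK]
    simpa using C_mul_monomial_eq_binaryForm (n := 4) (i := 1) (by norm_num) c
  have hKsq : covK (binaryForm 10 a) ^ 2 =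
      binaryForm 8 (fun l => if l = 2 then c ^ 2 / 28 else 0) := by
    have h := C_mul_monomial_eq_binaryForm (n := 8) (i := 2) (by norm_num) (c ^ 2)
    rw [show ((Nat.choose 8 2 : ℕ) : ℂ) = 28 by norm_num [Nat.choose]] at h
    rw [hK, ← h, C_pow]
    ring
  have hM : covM (binaryForm 10 a) = binaryForm 6 (fun l => -c * a (l + 3)) := by
    rw [covM, hK1, transv_binaryForm (by norm_num) (by norm_num)]
    refine Finset.sum_congr rfl fun l hl => ?_
    have hl' : l ≤ 6 := by simp at hl; omega
    congr 3
    clear hl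
    interval_cases l <;>
      simp [transvCoeff, Finset.sum_range_succ, Finset.Nat.antidiagonal_succ, Nat.choose] <;> ring
  have hKK : transv 4 4 2 (covK (binaryForm 10 a)) (covK (binaryForm 10 a)) ^ 2 =
      binaryForm 8 (fun l => if l = 0 then c ^ 4 / 64 else 0) := by
    have h : transv 4 4 2 (covK (binaryForm 10 a)) (covK (binaryForm 10 a)) =
        C (-(c ^ 2 / 8)) * X 0 ^ 4 := by
      have h4 := C_mul_monomial_eq_binaryForm (n := 4) (i := 0) (by norm_num) (-(c ^ 2 / 8))
      simp only [tsub_zero, pow_zero, mul_one] at h4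
      rw [h4, hK1, transv_binaryForm (by norm_num) (by norm_num)]
      refine Finset.sum_congr rfl fun l hl => ?_
      have hl' : l ≤ 4 := by simp at hl; omega
      congr 3
      clear hl
      interval_cases l <;>
        simp [transvCoeff, Finset.sum_range_succ, Finset.Nat.antidiagonal_succ, Nat.choose]
      ring
    have h8 := C_mul_monomial_eq_binaryForm (n := 8) (i := 0) (by norm_num) (c ^ 4 / 64)
    simp only [tsub_zero, pow_zero, mul_one, Nat.choose_zero_right, Nat.cast_one, div_one] at h8
    rw [h, ← h8, mul_pow, ← C_pow, ← pow_mul]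
    congr 2
    ring
  have a9 : a 9 = 0 := by
    rw [j9, hKsq, hK1, hM, transv_binaryForm (by norm_num) (by norm_num),
      transv_binaryForm (by norm_num) (by norm_num)] at h9
    have h := binaryForm_eq_zero h9 (i := 0) (by norm_num)
    simp [transvCoeff, Finset.sum_range_succ, Finset.Nat.antidiagonal_succ, Nat.choose] at h
    simpa [hc] using h
  have a8 : a 8 = 0 := by
    rw [A14, hKK, hM, transv_binaryForm (by norm_num) (by norm_num),
      transv_binaryForm (by norm_num) (by norm_num)] at h14
    have h := binaryForm_eq_zero h14 (i := 0) (by norm_num)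
    simp [transvCoeff, Finset.sum_range_succ, Finset.Nat.antidiagonal_succ, Nat.choose, a9] at h
    simpa [hc] using h
  have a7 : a 7 = 0 := by
    rw [j10, hKsq, hM, transv_binaryForm (by norm_num) (by norm_num),
      transv_binaryForm (by norm_num) (by norm_num)] at h10
    have h := binaryForm_eq_zero h10 (i := 0) (by norm_num)
    simp [transvCoeff, Finset.sum_range_succ, Finset.Nat.antidiagonal_succ, Nat.choose, a9, a8] at h
    have h' : (c * a 7) ^ 2 = 0 := by linear_combination (-7 / 5) * h.resolve_right hc
    simpa [hc] using h'
  have a6 : a 6 = 0 := by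
    rw [A6, hM, transv_binaryForm (by norm_num) (by norm_num)] at h6
    have h := binaryForm_eq_zero h6 (i := 0) (by norm_num)
    simp [transvCoeff, Finset.sum_range_succ, Nat.choose, a9, a8, a7] at h
    simpa [hc] using h
  rw [j2, transv_binaryForm (by norm_num) (by norm_num)] at h2
  rw [covK, transv_binaryForm (by norm_num) (by norm_num)] at hK1
  have e0 := binaryForm_eq_zero h2 (i := 0) (by norm_num)
  have e1 := binaryForm_injective hK1 (i := 1) (by norm_num)
  have e2 := binaryForm_injective hK1 (i := 2) (by norm_num)
  simp [transvCoeff, Finset.sum_range_succ, Finset.Nat.antidiagonal_succ, Nat.choose, a9, a8, a7, a6]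
    at e0 e1 e2
  have a5 : a 5 = 0 := by
    have : a 5 ^ 2 = 0 := by linear_combination (6 * e2 - e0) / 420
    simpa using this
  simp [a5] at e1
  exact hc (by linear_combination -4 * e1)
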